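/- arXiv:2405.20065 — 3 statements merged into one kernel-verified Lean document; each statement's English description precedes it below -/
import Mathlib

section
/- Let (P, 𝒜, μ) be a measure space with μ a probability measure, let U and V be separable real Hilbert spaces, and let (b_p)_{p ∈ P} be a parametric bilinear family (each b_p : U × V → ℝ bilinear, p ↦ b_p(u,v) μ-measurable for all u, v, with an essential uniform bound on the norms). Suppose there are constants 0 < c_b ≤ C_b < ∞ such that for μ-a.e. p ∈ P: (i) |b_p(u,v)| ≤ C_b‖u‖_U‖v‖_V for all u, v; (ii) sup_{v ≠ 0} b_p(u,v)/‖v‖_V ≥ c_b‖u‖_U for all u ∈ U; (iii) for every v ∈ V with v ≠ 0 there exists u ∈ U with b_p(u,v) ≠ 0. Then the lifted bilinear form 𝔟(w,v) := ∫_P b_p(w(p), v(p)) dμ(p) on L²(μ;U) × L²(μ;V) satisfies with the same constants: |𝔟(w,v)| ≤ C_b‖w‖_{L²(μ;U)}‖v‖_{L²(μ;V)} for all w, v; sup_{v ≠ 0} 𝔟(w,v)/‖v‖_{L²(μ;V)} ≥ c_b‖w‖_{L²(μ;U)} for all w ∈ L²(μ;U); and for every v ∈ L²(μ;V) with v ≠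 0 there exists w ∈ L²(μ;U) with 𝔟(w,v) ≠ 0. -/
open MeasureTheory

noncomputable section

theorem pettis_aux {P : Type*} [MeasurableSpace P] {μ : Measure P} {H : Type*}
    [NormedAddCommGroup H] [InnerProductSpace ℝ H] [CompleteSpace H] [SecondCountableTopology H]
    (f : P → H) (hf : ∀ h : H, AEStronglyMeasurable (fun p => inner ℝ h (f p)) μ) :
    AEStronglyMeasurable f μ := by
  obtain ⟨s, e, -⟩ := exists_hilbertBasis ℝ H
  have hc : Countable s := by
    have ho := e.orthonormal
    refine Pairwise.countable_of_isOpen_disjoint (s := fun i : s => Metric.ball (e i) (1 / 2))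
      ?_ (fun i => Metric.isOpen_ball) (fun i => ⟨e i, Metric.mem_ball_self (by norm_num)⟩)
    intro i j hij
    refine Metric.ball_disjoint_ball ?_
    have h := norm_sub_sq_real (e i) (e j)
    rw [ho.1 i, ho.1 j, ho.2 hij] at h
    rw [dist_eq_norm]
    nlinarith [norm_nonneg (e i - e j)]
  refine aestronglyMeasurable_of_tendsto_ae (Filter.atTop : Filter (Finset s))
    (f := fun t p => ∑ i ∈ t, inner ℝ (e i) (f p) • e i) ?_ ?_
  · intro t
    exact Finset.aestronglyMeasurable_fun_sum t fun i _ => (hf (e i)).smul_const _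
  · refine Filter.Eventually.of_forall fun p => ?_
    have := e.hasSum_repr (f p)
    simp only [e.repr_apply_apply] at this
    exact this

theorem riesz_aux {H : Type*}
    [NormedAddCommGroup H] [InnerProductSpace ℝ H] [CompleteSpace H] (L : H →ₗ[ℝ] ℝ) :
    ∃ z : H, (∃ C : ℝ, ∀ v, |L v| ≤ C * ‖v‖) → ∀ v, inner ℝ z v = L v := by
  by_cases h : ∃ C : ℝ, ∀ v, |L v| ≤ C * ‖v‖
  · obtain ⟨C, hC⟩ := h
    refine ⟨(InnerProductSpace.toDual ℝ H).symm (L.mkContinuous C hC), fun _ v => ?_⟩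
    rw [InnerProductSpace.toDual_symm_apply]
    rfl
  · exact ⟨0, fun h' => absurd h' h⟩

theorem key_aux {P : Type*} [MeasurableSpace P] {μ : Measure P}
    {U V : Type*}
    [NormedAddCommGroup U] [InnerProductSpace ℝ U] [CompleteSpace U] [SecondCountableTopology U]
    [NormedAddCommGroup V] [InnerProductSpace ℝ V] [CompleteSpace V] [SecondCountableTopology V]
    (b : P → U →ₗ[ℝ] V →ₗ[ℝ] ℝ)
    (hmeas : ∀ (u : U) (v : V), Measurable fun p => b p u v) (C : ℝ) (hC : 0 ≤ C)
    (hb : ∀ᵐ p ∂μ, ∀ (u : U) (v : V), |b p u v| ≤ C * ‖u‖ * ‖v‖) (w : Lp U 2 μ) :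
    ∃ z : Lp V 2 μ, (∀ᵐ p ∂μ, ∀ v, inner ℝ (z p) v = b p (w p) v) ∧
      (∀ᵐ p ∂μ, ‖z p‖ ≤ C * ‖w p‖) ∧
      ∀ v : Lp V 2 μ, ∫ p, b p (w p) (v p) ∂μ = inner ℝ z v := by
  choose S hS using fun (p : P) (v : V) => riesz_aux ((b p).flip v)
  choose T hT using fun (p : P) (u : U) => riesz_aux (b p u)
  have hS' : ∀ᵐ p ∂μ, ∀ v u, inner ℝ (S p v) u = b p u v := by
    filter_upwards [hb] with p hp v u
    exact hS p v ⟨C * ‖v‖, fun u => (hp u v).trans_eq (by ring)⟩ u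
  have hT' : ∀ᵐ p ∂μ, ∀ u v, inner ℝ (T p u) v = b p u v := by
    filter_upwards [hb] with p hp u v
    exact hT p u ⟨C * ‖u‖, fun v => hp u v⟩ v
  have mS : ∀ v, AEStronglyMeasurable (fun p => S p v) μ := by
    intro v
    refine pettis_aux _ fun u => ?_
    refine (hmeas u v).aestronglyMeasurable.congr ?_
    filter_upwards [hS'] with p hp
    rw [real_inner_comm, hp]
  have mT : AEStronglyMeasurable (fun p => T p (w p)) μ := by
    refine pettis_aux _ fun v => ?_
    refine ((mS v).inner (𝕜 := ℝ) (Lp.aestronglyMeasurable w)).congr ?_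
    filter_upwards [hS', hT'] with p hp hp'
    rw [real_inner_comm _ v, hp, hp']
  have nT : ∀ᵐ p ∂μ, ‖T p (w p)‖ ≤ C * ‖w p‖ := by
    filter_upwards [hb, hT'] with p hp hp'
    have h1 := hp (w p) (T p (w p))
    rw [← hp', real_inner_self_eq_norm_sq, abs_of_nonneg (by positivity), sq] at h1
    by_cases h0 : ‖T p (w p)‖ = 0
    · rw [h0]; positivity
    · exact le_of_mul_le_mul_right h1 (lt_of_le_of_ne (norm_nonneg _) (Ne.symm h0))
  have mem : MemLp (fun p => T p (w p)) 2 μ := (Lp.memLp w).of_le_mul mT nT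
  refine ⟨mem.toLp _, ?_, ?_, ?_⟩
  · filter_upwards [mem.coeFn_toLp, hT'] with p h1 h2 v
    rw [h1, h2]
  · filter_upwards [mem.coeFn_toLp, nT] with p h1 h2
    rwa [h1]
  · intro v
    rw [L2.inner_def]
    refine integral_congr_ae ?_
    filter_upwards [mem.coeFn_toLp, hT'] with p h1 h2
    rw [h1, h2]

/-- Forward direction of the lifting theorem: if the fiber bilinear forms satisfy the
Babuška–Nečas conditions (boundedness, inf-sup, nondegeneracy) uniformly for μ-a.e. parameter,
then the lifted bilinear form `𝔟(w,v) = ∫ b_p(w(p), v(p)) dμ(p)` on `L²(μ;U) × L²(μ;V)`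
satisfies the same three conditions with the same constants. -/
theorem lifted_form_babuska_necas
    {P : Type*} [MeasurableSpace P] (μ : Measure P) [IsProbabilityMeasure μ]
    {U V : Type*}
    [NormedAddCommGroup U] [InnerProductSpace ℝ U] [CompleteSpace U] [SecondCountableTopology U]
    [NormedAddCommGroup V] [InnerProductSpace ℝ V] [CompleteSpace V] [SecondCountableTopology V]
    (b : P → U →ₗ[ℝ] V →ₗ[ℝ] ℝ)
    (hmeas : ∀ (u : U) (v : V), Measurable fun p => b p u v)
    (cb Cb : ℝ) (hcb : 0 < cb) (hcbCb : cb ≤ Cb)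
    (hae : ∀ᵐ p ∂μ,
      (∀ (u : U) (v : V), |b p u v| ≤ Cb * ‖u‖ * ‖v‖) ∧
      (∀ u : U, cb * ‖u‖ ≤ ⨆ v : {v : V // v ≠ 0}, b p u v.1 / ‖v.1‖) ∧
      (∀ v : V, v ≠ 0 → ∃ u : U, b p u v ≠ 0)) :
    (∀ (w : Lp U 2 μ) (v : Lp V 2 μ),
        |∫ p, b p (w p) (v p) ∂μ| ≤ Cb * ‖w‖ * ‖v‖) ∧
    (∀ w : Lp U 2 μ,
        cb * ‖w‖ ≤
          ⨆ v : {v : Lp V 2 μ // v ≠ 0}, (∫ p, b p (w p) (v.1 p) ∂μ) / ‖v.1‖) ∧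
    (∀ v : Lp V 2 μ, v ≠ 0 → ∃ w : Lp U 2 μ, (∫ p, b p (w p) (v p) ∂μ) ≠ 0) := by
  have hC : 0 ≤ Cb := hcb.le.trans hcbCb
  have hb : ∀ᵐ p ∂μ, ∀ (u : U) (v : V), |b p u v| ≤ Cb * ‖u‖ * ‖v‖ := hae.mono fun p h => h.1
  have h1 : ∀ (w : Lp U 2 μ) (v : Lp V 2 μ),
      |∫ p, b p (w p) (v p) ∂μ| ≤ Cb * ‖w‖ * ‖v‖ := by
    intro w v
    obtain ⟨z, -, hz, hi⟩ := key_aux b hmeas Cb hC hb w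
    rw [hi]
    refine (abs_real_inner_le_norm z v).trans ?_
    gcongr
    exact Lp.norm_le_mul_norm_of_ae_le_mul hz
  refine ⟨h1, ?_, ?_⟩
  · intro w
    obtain ⟨z, hzi, hz, hi⟩ := key_aux b hmeas Cb hC hb w
    have hw : ‖w‖ ≤ cb⁻¹ * ‖z‖ := by
      refine Lp.norm_le_mul_norm_of_ae_le_mul ?_
      filter_upwards [hae, hzi] with p hp hq
      rw [← div_eq_inv_mul, le_div_iff₀ hcb, mul_comm]
      refine (hp.2.1 (w p)).trans (Real.iSup_le (fun v => ?_) (norm_nonneg _))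
      rw [div_le_iff₀ (norm_pos_iff.2 v.2), ← hq]
      exact real_inner_le_norm _ _
    have hw' : cb * ‖w‖ ≤ ‖z‖ := by
      rwa [← div_eq_inv_mul, le_div_iff₀ hcb, mul_comm] at hw
    refine hw'.trans ?_
    by_cases h0 : z = 0
    · subst h0
      rw [norm_zero]
      refine Real.iSup_nonneg fun v => ?_
      rw [hi]; simp
    · refine le_trans (le_of_eq ?_) (le_ciSup (f := fun v : {v : Lp V 2 μ // v ≠ 0} =>
        (∫ p, b p (w p) (v.1 p) ∂μ) / ‖v.1‖) ?_ ⟨z, h0⟩)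
      · simp only [hi]
        have := norm_pos_iff.2 h0
        rw [real_inner_self_eq_norm_sq]
        field_simp
      · refine ⟨Cb * ‖w‖, ?_⟩
        rintro _ ⟨v, rfl⟩
        exact (div_le_iff₀ (norm_pos_iff.2 v.2)).2 ((le_abs_self _).trans (h1 w v.1))
  · intro v hv
    obtain ⟨z, hzi, -, hi⟩ := key_aux (fun p => (b p).flip) (fun v u => hmeas u v) Cb hC
      (hb.mono fun p h v u => (h u v).trans_eq (by ring)) v
    refine ⟨z, fun h => hv ?_⟩
    have hz : z = 0 := by
      have := hi z
      simp only [LinearMap.flip_apply] at this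
      rw [h] at this
      exact inner_self_eq_zero.1 this.symm
    subst hz
    rw [Lp.eq_zero_iff_ae_eq_zero]
    filter_upwards [hae, hzi, Lp.coeFn_zero U 2 μ] with p hp hq h0
    by_contra hne
    obtain ⟨u, hu⟩ := hp.2.2 (v p) hne
    apply hu
    have := hq u
    rw [h0] at this
    simpa using this.symm
end
end

section
/- Let (P, 𝒜, μ) be a measure space with μ a probability measure, let U and V be separable real Hilbert spaces, and let (b_p)_{p ∈ P} be a parametric bilinear family (each b_p : U × V → ℝ bilinear, p ↦ b_p(u,v) μ-measurable for all u, v, with an essential uniform bound on the norms). Suppose the lifted bilinear form 𝔟(w,v) := ∫_P b_p(w(p), v(p)) dμ(p) satisfies the inf-sup condition sup_{v ≠ 0} 𝔟(w,v)/‖v‖_{L²(μ;V)} ≥ c_b‖w‖_{L²(μ;U)} for all w ∈ L²(μ;U) with some c_b > 0. Then for every w ∈ L²(μ;U), the set { p ∈ P : ‖b_p(w(p),·)‖_{V'} < (c_b/2)‖w(p)‖_U } is μ-null. -/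
open MeasureTheory

noncomputable section

/-- Cauchy-Schwarz for the pointwise norms of two Bochner `L²` functions. -/
theorem aux_cauchy_schwarz {P : Type*} [MeasurableSpace P] (μ : Measure P)
    {U V : Type*} [NormedAddCommGroup U] [NormedAddCommGroup V]
    (w : Lp U 2 μ) (v : Lp V 2 μ) :
    Integrable (fun p => ‖w p‖ * ‖v p‖) μ ∧ ∫ p, ‖w p‖ * ‖v p‖ ∂μ ≤ ‖w‖ * ‖v‖ := by
  have hw := (Lp.memLp w).norm
  have hv := (Lp.memLp v).norm
  have e : (fun p => inner ℝ (hw.toLp _ p) (hv.toLp _ p)) =ᵐ[μ] fun p => ‖w p‖ * ‖v p‖ := by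
    filter_upwards [hw.coeFn_toLp, hv.coeFn_toLp] with p h1 h2
    rw [h1, h2]; simp [mul_comm]
  refine ⟨(L2.integrable_inner (𝕜 := ℝ) (hw.toLp _) (hv.toLp _)).congr e, ?_⟩
  rw [← integral_congr_ae e, ← L2.inner_def]
  refine (real_inner_le_norm _ _).trans (le_of_eq ?_)
  rw [Lp.norm_toLp, Lp.norm_toLp, eLpNorm_norm, eLpNorm_norm, Lp.norm_def, Lp.norm_def]

theorem aux_aemeasurable {P : Type*} [MeasurableSpace P] (μ : Measure P)
    {U V : Type*} [NormedAddCommGroup U] [InnerProductSpace ℝ U]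
    [NormedAddCommGroup V] [InnerProductSpace ℝ V]
    (b : P → U →ₗ[ℝ] V →ₗ[ℝ] ℝ)
    (hmeas : ∀ (u : U) (v : V), Measurable fun p => b p u v)
    (C : ℝ) (hC : ∀ᵐ p ∂μ, ∀ (u : U) (v : V), |b p u v| ≤ C * ‖u‖ * ‖v‖)
    (w : P → U) (hw : StronglyMeasurable w) (v : V) :
    AEMeasurable (fun p => b p (w p) v) μ := by
  refine aemeasurable_of_tendsto_metrizable_ae Filter.atTop
    (f := fun n p => b p (hw.approx n p) v)
    (fun n => ((hw.approx n).measurable_bind (fun u p => b p u v)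
      (fun u => hmeas u v)).aemeasurable) ?_
  filter_upwards [hC] with p hp
  have hc : Continuous ((b p).flip v) :=
    AddMonoidHomClass.continuous_of_bound ((b p).flip v) (C * ‖v‖) (fun u => by
      have := hp u v
      simp only [LinearMap.flip_apply, Real.norm_eq_abs]
      linarith)
  exact (hc.tendsto (w p)).comp (hw.tendsto_approx p)

/-- Lower-bound part of the converse direction of the lifting theorem: if the lifted
bilinear form satisfies the inf-sup condition with constant `c_b`, then for every
`w ∈ L²(μ;U)` the set of parameters where the fiber residual dual norm drops below
`(c_b/2)‖w(p)‖` is μ-null. -/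
theorem lifted_infsup_implies_fiber_lower_bound
    {P : Type*} [MeasurableSpace P] (μ : Measure P) [IsProbabilityMeasure μ]
    {U V : Type*}
    [NormedAddCommGroup U] [InnerProductSpace ℝ U] [CompleteSpace U] [SecondCountableTopology U]
    [NormedAddCommGroup V] [InnerProductSpace ℝ V] [CompleteSpace V] [SecondCountableTopology V]
    (b : P → U →ₗ[ℝ] V →ₗ[ℝ] ℝ)
    (hmeas : ∀ (u : U) (v : V), Measurable fun p => b p u v)
    (C : ℝ) (hC : ∀ᵐ p ∂μ, ∀ (u : U) (v : V), |b p u v| ≤ C * ‖u‖ * ‖v‖)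
    (cb : ℝ) (hcb : 0 < cb)
    (hinfsup : ∀ w : Lp U 2 μ,
      cb * ‖w‖ ≤ ⨆ v : {v : Lp V 2 μ // v ≠ 0}, (∫ p, b p (w p) (v.1 p) ∂μ) / ‖v.1‖) :
    ∀ w : Lp U 2 μ,
      μ {p : P | (⨆ v : {v : V // v ≠ 0}, b p (w p) v.1 / ‖v.1‖) < (cb / 2) * ‖w p‖} = 0 := by
  intro w
  set T : Set P := {p | ∀ n, b p (w p) (TopologicalSpace.denseSeq V n)
    ≤ cb / 2 * ‖w p‖ * ‖TopologicalSpace.denseSeq V n‖} with hT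
  have hws := Lp.stronglyMeasurable w
  have hTm : NullMeasurableSet T μ := by
    rw [hT, Set.setOf_forall]
    refine NullMeasurableSet.iInter fun n => ?_
    refine nullMeasurableSet_le (aux_aemeasurable μ b hmeas C hC w hws _) ?_
    exact ((hws.norm.measurable.const_mul _).mul_const _).aemeasurable
  obtain ⟨S, -, hS, hST⟩ := hTm.exists_measurable_superset_ae_eq
  have hTbd : ∀ᵐ p ∂μ, p ∈ S → ∀ v, |b p (w p) v| ≤ cb / 2 * ‖w p‖ * ‖v‖ := by
    filter_upwards [hC, hST.mem_iff] with p hp hpe hpS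
    have hpT : p ∈ T := hpe.1 hpS
    have hc : Continuous (b p (w p)) :=
      AddMonoidHomClass.continuous_of_bound (b p (w p)) (C * ‖w p‖) (hp (w p))
    have key : ∀ v, b p (w p) v ≤ cb / 2 * ‖w p‖ * ‖v‖ := by
      intro v
      have hcl : IsClosed {v : V | b p (w p) v ≤ cb / 2 * ‖w p‖ * ‖v‖} :=
        isClosed_le hc (continuous_const.mul continuous_norm)
      have hd := TopologicalSpace.denseRange_denseSeq V
      exact hd.induction_on (p := fun v => b p (w p) v ≤ cb / 2 * ‖w p‖ * ‖v‖) v hcl hpT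
    intro v
    refine abs_le.2 ⟨?_, key v⟩
    have := key (-v)
    rw [map_neg, norm_neg] at this
    linarith
  have hmem := (Lp.memLp w).indicator hS
  set w' : Lp U 2 μ := hmem.toLp _ with hw'
  have hco : w' =ᵐ[μ] S.indicator w := hmem.coeFn_toLp
  have hbd : ∀ v : Lp V 2 μ, ∫ p, b p (w' p) (v p) ∂μ ≤ cb / 2 * ‖w'‖ * ‖v‖ := by
    intro v
    obtain ⟨hi, hle⟩ := aux_cauchy_schwarz μ w' v
    have h1 : ‖∫ p, b p (w' p) (v p) ∂μ‖ ≤ ∫ p, cb / 2 * (‖w' p‖ * ‖v p‖) ∂μ := by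
      refine norm_integral_le_of_norm_le (hi.const_mul _) ?_
      filter_upwards [hTbd, hco] with p hp hpe
      rw [hpe]
      by_cases hpS : p ∈ S
      · rw [Set.indicator_of_mem hpS, ← mul_assoc]
        exact hp hpS _
      · simp [Set.indicator_of_notMem hpS]
    rw [integral_const_mul] at h1
    have h2 := mul_le_mul_of_nonneg_left hle (by positivity : 0 ≤ cb / 2)
    have h3 := le_abs_self (∫ p, b p (w' p) (v p) ∂μ)
    rw [Real.norm_eq_abs] at h1
    linarith
  have hsup := (hinfsup w').trans (Real.iSup_le (a := cb / 2 * ‖w'‖) (fun v => by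
    have : 0 < ‖v.1‖ := norm_pos_iff.2 v.2
    rw [div_le_iff₀ this]
    exact hbd v.1) (by positivity))
  have h0 : w' = 0 := by
    rw [← norm_le_zero_iff]
    by_contra hlt
    push Not at hlt
    nlinarith [mul_pos hcb hlt]
  have hz : ∀ᵐ p ∂μ, p ∈ S → w p = 0 := by
    have hzero : w' =ᵐ[μ] 0 := by rw [h0]; exact Lp.coeFn_zero U 2 μ
    filter_upwards [hco, hzero] with p h1 h2 hpS
    rw [h2, Set.indicator_of_mem hpS] at h1
    exact h1.symm
  have hfin : ∀ᵐ p ∂μ,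
      ¬ ((⨆ v : {v : V // v ≠ 0}, b p (w p) v.1 / ‖v.1‖) < (cb / 2) * ‖w p‖) := by
    filter_upwards [hz, hC, hST.mem_iff] with p hp hpC hpe hlt
    have hpT : p ∈ T := by
      intro n
      by_cases hn : TopologicalSpace.denseSeq V n = 0
      · simp [hn]
      have hpos := norm_pos_iff.2 hn
      rw [← div_le_iff₀ hpos]
      refine le_trans (le_ciSup (f := fun v : {v : V // v ≠ 0} => b p (w p) v.1 / ‖v.1‖)
        ⟨C * ‖w p‖, ?_⟩ ⟨_, hn⟩) hlt.le
      rintro _ ⟨v, rfl⟩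
      have hv : 0 < ‖v.1‖ := norm_pos_iff.2 v.2
      simp only
      rw [div_le_iff₀ hv]
      exact (le_abs_self _).trans (hpC _ _)
    have hw0 := hp (hpe.2 hpT)
    simp [hw0] at hlt
  simpa [ae_iff] using hfin
end
end

section
/- Let (P, 𝒜, μ) be a measure space with μ a probability measure, let U and V be separable real Hilbert spaces, and let (b_p)_{p ∈ P} be a parametric bilinear family (each b_p : U × V → ℝ bilinear, p ↦ b_p(u,v) μ-measurable for all u, v, with an essential uniform bound on the norms), and let 𝔅 : L²(μ;U) → (L²(μ;V))' be the lifted operator defined by (𝔅w)(v) = ∫_P b_p(w(p), v(p)) dμ(p). Then 𝔅 is a Banach space isomorphism if and only if there exist constants 0 < c_b ≤ C_b < ∞ such that for μ-a.e. p ∈ P: |b_p(u,v)| ≤ C_b‖u‖_U‖v‖_V for all u, v; sup_{v ≠ 0} b_p(u,v)/‖v‖_V ≥ c_b‖u‖_U for all u ∈ U; and for every v ≠ 0 in V there exists u ∈ U with b_p(u,v) ≠ 0. -/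
open MeasureTheory

noncomputable section

namespace LiftAux

/-- Pettis-type lemma: weak measurability implies strong measurability. -/
theorem stronglyMeasurable_of_inner {P V : Type*} [MeasurableSpace P]
    [NormedAddCommGroup V] [InnerProductSpace ℝ V] [CompleteSpace V] [SecondCountableTopology V]
    (f : P → V) (hf : ∀ v, Measurable fun p => inner ℝ (f p) v) : StronglyMeasurable f := by
  borelize V
  have : PolishSpace V := {}
  let Φ : V → ℕ → ℝ := fun x n => inner ℝ x (TopologicalSpace.denseSeq V n)
  have hΦc : Continuous Φ := by
    refine continuous_pi fun n => ?_
    simp only [Φ]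
    fun_prop
  have hΦi : Function.Injective Φ := by
    intro x y hxy
    have h1 : (fun z => inner ℝ x z) = fun z => inner ℝ y z := by
      refine (TopologicalSpace.denseRange_denseSeq V).equalizer (by fun_prop) (by fun_prop) ?_
      funext n
      exact congrFun hxy n
    exact ext_inner_right ℝ fun z => congrFun h1 z
  have he : MeasurableEmbedding Φ := hΦc.measurableEmbedding hΦi
  have : Measurable f := by
    rw [← he.measurable_comp_iff]
    exact measurable_pi_lambda _ fun n => hf _
  exact this.stronglyMeasurable

variable {P : Type*} [MeasurableSpace P] {μ : Measure P}
  {U V : Type*}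
  [NormedAddCommGroup U] [InnerProductSpace ℝ U] [CompleteSpace U] [SecondCountableTopology U]
  [NormedAddCommGroup V] [InnerProductSpace ℝ V] [CompleteSpace V] [SecondCountableTopology V]

theorem memLp_fiber (B : P → U →L[ℝ] V) (hB : ∀ u, StronglyMeasurable fun p => B p u)
    (C : ℝ) (hC : ∀ p, ‖B p‖ ≤ C) (w : Lp U 2 μ) : MemLp (fun p => B p (w p)) 2 μ := by
  borelize U
  have h1 : StronglyMeasurable (Function.uncurry fun (u : U) (p : P) => B p u) :=
    stronglyMeasurable_uncurry_of_continuous_of_stronglyMeasurable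
      (fun p => (B p).continuous) hB
  have h2 : StronglyMeasurable fun p => B p (w p) :=
    h1.comp_measurable ((Lp.stronglyMeasurable w).measurable.prodMk measurable_id)
  exact (Lp.memLp w).of_le_mul (c := C) h2.aestronglyMeasurable
    (Filter.Eventually.of_forall fun p => (B p).le_of_opNorm_le (hC p) _)

theorem exists_lift (B : P → U →L[ℝ] V) (hB : ∀ u, StronglyMeasurable fun p => B p u)
    (C : ℝ) (hC : ∀ p, ‖B p‖ ≤ C) :
    ∃ T : Lp U 2 μ →L[ℝ] Lp V 2 μ, ∀ w, T w =ᵐ[μ] fun p => B p (w p) := by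
  have hm := memLp_fiber (μ := μ) B hB C hC
  let T0 : Lp U 2 μ →ₗ[ℝ] Lp V 2 μ :=
    { toFun := fun w => (hm w).toLp _
      map_add' := by
        intro x y
        ext1
        filter_upwards [(hm (x + y)).coeFn_toLp, (hm x).coeFn_toLp, (hm y).coeFn_toLp,
          Lp.coeFn_add x y, Lp.coeFn_add ((hm x).toLp _) ((hm y).toLp _)] with p h1 h2 h3 h4 h5
        rw [h1, h5, Pi.add_apply, h2, h3, h4, Pi.add_apply, map_add]
      map_smul' := by
        intro a x
        ext1
        filter_upwards [(hm (a • x)).coeFn_toLp, (hm x).coeFn_toLp,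
          Lp.coeFn_smul a x, Lp.coeFn_smul a ((hm x).toLp _)] with p h1 h2 h4 h5
        simp only [RingHom.id_apply]
        rw [h1, h5, Pi.smul_apply, h2, h4, Pi.smul_apply, map_smul] }
  refine ⟨T0.mkContinuous C ?_, fun w => (hm w).coeFn_toLp⟩
  intro w
  refine Lp.norm_le_mul_norm_of_ae_le_mul ?_
  filter_upwards [(hm w).coeFn_toLp] with p hp
  change ‖(hm w).toLp _ p‖ ≤ _
  rw [hp]
  exact (B p).le_of_opNorm_le (hC p) _

/-- A lower bound for the lifted operator gives a lower bound for almost all fibers. -/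
theorem fiber_bound [IsFiniteMeasure μ]
    (B : P → U →L[ℝ] V) (hB : ∀ u, StronglyMeasurable fun p => B p u)
    (T : Lp U 2 μ →L[ℝ] Lp V 2 μ) (hT : ∀ w, T w =ᵐ[μ] fun p => B p (w p))
    (c : ℝ) (hc : 0 < c) (hl : ∀ w, c * ‖w‖ ≤ ‖T w‖) :
    ∀ᵐ p ∂μ, ∀ u, c / 2 * ‖u‖ ≤ ‖B p u‖ := by
  have key : ∀ u : U, ∀ᵐ p ∂μ, c / 2 * ‖u‖ ≤ ‖B p u‖ := by
    intro u
    by_cases hu : u = 0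
    · simp [hu]
    let A : Set P := {p | ‖B p u‖ < c / 2 * ‖u‖}
    have hA : MeasurableSet A := measurableSet_lt (hB u).norm.measurable measurable_const
    let w : Lp U 2 μ := indicatorConstLp 2 hA (measure_ne_top μ A) u
    have h1 : ‖T w‖ ≤ c / 2 * ‖w‖ := by
      refine Lp.norm_le_mul_norm_of_ae_le_mul ?_
      filter_upwards [hT w, indicatorConstLp_coeFn (p := 2) (hs := hA)
        (hμs := measure_ne_top μ A) (c := u)] with p h1 h2
      rw [h1]
      change w p = _ at h2
      rw [h2]
      by_cases hp : p ∈ A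
      · simpa [hp] using le_of_lt hp
      · simp [hp]
    have h2 : ‖w‖ = 0 := by
      have := hl w
      have := norm_nonneg w
      nlinarith
    rw [norm_indicatorConstLp (by simp) (by simp)] at h2
    have h3 : μ.real A = 0 := by
      rcases mul_eq_zero.1 h2 with h | h
      · exact absurd (norm_eq_zero.1 h) hu
      · exact (Real.rpow_eq_zero (by positivity) (by simp)).1 h
    have h4 : μ A = 0 := by
      rwa [measureReal_eq_zero_iff] at h3
    rw [ae_iff]
    simpa [A] using h4
  have h5 : ∀ᵐ p ∂μ, ∀ n, c / 2 * ‖TopologicalSpace.denseSeq U n‖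
      ≤ ‖B p (TopologicalSpace.denseSeq U n)‖ := ae_all_iff.2 fun n => key _
  filter_upwards [h5] with p hp
  intro u
  have hcl : IsClosed {u : U | c / 2 * ‖u‖ ≤ ‖B p u‖} :=
    isClosed_le (by fun_prop) (by fun_prop)
  exact (TopologicalSpace.denseRange_denseSeq U).induction_on u hcl hp

theorem lift_inner (B : P → U →L[ℝ] V)
    (T : Lp U 2 μ →L[ℝ] Lp V 2 μ) (hT : ∀ w, T w =ᵐ[μ] fun p => B p (w p))
    (S : Lp V 2 μ →L[ℝ] Lp U 2 μ) (hS : ∀ v, S v =ᵐ[μ] fun p => (B p).adjoint (v p))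
    (w : Lp U 2 μ) (v : Lp V 2 μ) : inner ℝ (T w) v = inner ℝ w (S v) := by
  rw [L2.inner_def, L2.inner_def]
  refine integral_congr_ae ?_
  filter_upwards [hT w, hS v] with p h1 h2
  rw [h1, h2, ContinuousLinearMap.adjoint_inner_right]

theorem exists_riesz (b : U →ₗ[ℝ] V →ₗ[ℝ] ℝ) (C : ℝ)
    (h : ∀ u v, |b u v| ≤ C * ‖u‖ * ‖v‖) :
    ∃ B : U →L[ℝ] V, ∀ u v, inner ℝ (B u) v = b u v := by
  let F := LinearMap.mkContinuous₂ b C h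
  let B0 : U →ₗ[ℝ] V :=
    { toFun := fun u => (InnerProductSpace.toDual ℝ V).symm (F u)
      map_add' := by intro x y; simp
      map_smul' := by intro x y; simp }
  refine ⟨B0.mkContinuous ‖F‖ ?_, ?_⟩
  · intro u
    change ‖(InnerProductSpace.toDual ℝ V).symm (F u)‖ ≤ _
    rw [LinearIsometryEquiv.norm_map]
    exact F.le_opNorm u
  · intro u v
    change inner ℝ ((InnerProductSpace.toDual ℝ V).symm (F u)) v = _
    rw [InnerProductSpace.toDual_symm_apply]
    rfl

/-- Measurable Riesz representatives of the fiber forms. -/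
theorem exists_family (b : P → U →ₗ[ℝ] V →ₗ[ℝ] ℝ)
    (hmeas : ∀ (u : U) (v : V), Measurable fun p => b p u v)
    (C : ℝ) (hC : ∀ᵐ p ∂μ, ∀ (u : U) (v : V), |b p u v| ≤ C * ‖u‖ * ‖v‖) :
    ∃ B : P → U →L[ℝ] V, (∀ u, StronglyMeasurable fun p => B p u) ∧
      (∀ v, StronglyMeasurable fun p => (B p).adjoint v) ∧
      (∀ p, ‖B p‖ ≤ max C 0) ∧ ∀ᵐ p ∂μ, ∀ u v, inner ℝ (B p u) v = b p u v := by
  classical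
  obtain ⟨G, hG, hGm, hG2⟩ : ∃ G : Set P, (∀ᵐ p ∂μ, p ∈ G) ∧ MeasurableSet G ∧
      ∀ p ∈ G, ∀ (u : U) (v : V), |b p u v| ≤ C * ‖u‖ * ‖v‖ := by
    refine ⟨(toMeasurable μ {p | ∀ (u : U) (v : V), |b p u v| ≤ C * ‖u‖ * ‖v‖}ᶜ)ᶜ, ?_,
      (measurableSet_toMeasurable _ _).compl, fun p hp => ?_⟩
    · change (_ : Set P) ∈ ae μ
      rw [mem_ae_iff]
      change μ (toMeasurable μ {p | ∀ (u : U) (v : V), |b p u v| ≤ C * ‖u‖ * ‖v‖}ᶜ)ᶜᶜ = 0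
      rw [compl_compl, measure_toMeasurable]
      exact hC
    · by_contra hps
      exact hp (subset_toMeasurable _ _ hps)
  have hex : ∀ p, ∃ B : U →L[ℝ] V, ∀ u v, inner ℝ (B u) v = G.indicator (fun p => b p u v) p := by
    intro p
    by_cases hp : p ∈ G
    · simpa [hp] using exists_riesz (b p) C (hG2 p hp)
    · exact ⟨0, by simp [hp]⟩
  choose B hB using hex
  refine ⟨B, ?_, ?_, ?_, ?_⟩
  · intro u
    refine stronglyMeasurable_of_inner _ fun v => ?_
    simp only [hB]
    exact (hmeas u v).indicator hGm
  · intro v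
    refine stronglyMeasurable_of_inner _ fun u => ?_
    have : (fun p => inner ℝ ((B p).adjoint v) u) = fun p => G.indicator (fun p => b p u v) p := by
      funext p
      rw [ContinuousLinearMap.adjoint_inner_left, real_inner_comm, hB]
    rw [this]
    exact (hmeas u v).indicator hGm
  · intro p
    refine (B p).opNorm_le_bound (le_max_right _ _) fun u => ?_
    have h1 : inner ℝ (B p u) (B p u) ≤ max C 0 * ‖u‖ * ‖B p u‖ := by
      rw [hB]
      by_cases hp : p ∈ G
      · rw [Set.indicator_of_mem hp]
        refine (le_abs_self _).trans ((hG2 p hp _ _).trans ?_)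
        gcongr
        exact le_max_left _ _
      · rw [Set.indicator_of_notMem hp]
        positivity
    rw [real_inner_self_eq_norm_mul_norm] at h1
    by_cases h0 : ‖B p u‖ = 0
    · rw [h0]; positivity
    · exact le_of_mul_le_mul_right h1 (lt_of_le_of_ne (norm_nonneg _) (Ne.symm h0))
  · filter_upwards [hG] with p hp u v
    rw [hB, Set.indicator_of_mem hp]

theorem div_le_norm (x : V) (v : V) : inner ℝ x v / ‖v‖ ≤ ‖x‖ :=
  div_le_of_le_mul₀ (norm_nonneg _) (norm_nonneg _) (real_inner_le_norm x v)

theorem iSup_inner (x : V) : ⨆ v : {v : V // v ≠ 0}, inner ℝ x v.1 / ‖v.1‖ = ‖x‖ := by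
  apply le_antisymm
  · exact Real.iSup_le (fun v => div_le_norm x v.1) (norm_nonneg _)
  · by_cases hx : x = 0
    · simp [hx]
    · have h : BddAbove (Set.range fun v : {v : V // v ≠ 0} => inner ℝ x v.1 / ‖v.1‖) :=
        ⟨‖x‖, by rintro _ ⟨v, rfl⟩; exact div_le_norm x v.1⟩
      refine le_trans (le_of_eq ?_) (le_ciSup h ⟨x, hx⟩)
      have : ‖x‖ ≠ 0 := norm_ne_zero_iff.2 hx
      rw [real_inner_self_eq_norm_mul_norm]
      field_simp

theorem equiv_bound {F G : Type*} [NormedAddCommGroup F] [NormedSpace ℝ F]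
    [NormedAddCommGroup G] [NormedSpace ℝ G] (E : F ≃L[ℝ] G) :
    ∃ K : ℝ, 0 < K ∧ ∀ w, ‖w‖ ≤ K * ‖E w‖ := by
  refine ⟨‖(E.symm : G →L[ℝ] F)‖ + 1, by positivity, fun w => ?_⟩
  have := (E.symm : G →L[ℝ] F).le_opNorm (E w)
  simp only [ContinuousLinearEquiv.coe_coe, ContinuousLinearEquiv.symm_apply_apply] at this
  nlinarith [norm_nonneg (E w)]

end LiftAux

/-- Theorem 2.8 in the Bochner-space setting: the lifted operator
`𝔅 : L²(μ;U) → (L²(μ;V))'`, `(𝔅w)(v) = ∫ b_p(w(p), v(p)) dμ(p)`, is a Banach space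
isomorphism if and only if the fiber problems satisfy the Babuška–Nečas conditions
with uniform constants for μ-a.e. parameter. -/
theorem lifted_operator_isomorphism_iff_uniform_fiber_wellposedness
    {P : Type*} [MeasurableSpace P] (μ : Measure P) [IsProbabilityMeasure μ]
    {U V : Type*}
    [NormedAddCommGroup U] [InnerProductSpace ℝ U] [CompleteSpace U] [SecondCountableTopology U]
    [NormedAddCommGroup V] [InnerProductSpace ℝ V] [CompleteSpace V] [SecondCountableTopology V]
    (b : P → U →ₗ[ℝ] V →ₗ[ℝ] ℝ)
    (hmeas : ∀ (u : U) (v : V), Measurable fun p => b p u v)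
    (C : ℝ) (hC : ∀ᵐ p ∂μ, ∀ (u : U) (v : V), |b p u v| ≤ C * ‖u‖ * ‖v‖) :
    (∃ E : Lp U 2 μ ≃L[ℝ] (Lp V 2 μ →L[ℝ] ℝ),
        ∀ (w : Lp U 2 μ) (v : Lp V 2 μ), E w v = ∫ p, b p (w p) (v p) ∂μ) ↔
    (∃ cb Cb : ℝ, 0 < cb ∧ cb ≤ Cb ∧
        ∀ᵐ p ∂μ,
          (∀ (u : U) (v : V), |b p u v| ≤ Cb * ‖u‖ * ‖v‖) ∧
          (∀ u : U, cb * ‖u‖ ≤ ⨆ v : {v : V // v ≠ 0}, b p u v.1 / ‖v.1‖) ∧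
          (∀ v : V, v ≠ 0 → ∃ u : U, b p u v ≠ 0)) := by
  obtain ⟨B, hB, hBa, hBC, hBb⟩ := LiftAux.exists_family b hmeas C hC
  obtain ⟨T, hT⟩ := LiftAux.exists_lift (μ := μ) B hB _ hBC
  obtain ⟨S, hS⟩ := LiftAux.exists_lift (μ := μ) (fun p => (B p).adjoint) hBa (max C 0)
    (fun p => by rw [LinearIsometryEquiv.norm_map]; exact hBC p)
  have hTS := LiftAux.lift_inner B T hT S hS
  have hTb : ∀ (w : Lp U 2 μ) (v : Lp V 2 μ), ∫ p, b p (w p) (v p) ∂μ = inner ℝ (T w) v := by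
    intro w v
    rw [L2.inner_def]
    refine integral_congr_ae ?_
    filter_upwards [hT w, hBb] with p h1 h2
    rw [h1, h2]
  simp only [hTb]
  constructor
  · rintro ⟨E, hE⟩
    obtain ⟨K, hK, hKE⟩ := LiftAux.equiv_bound (F := Lp U 2 μ) (G := Lp V 2 μ →L[ℝ] ℝ) E
    have hET : ∀ w, ‖E w‖ ≤ ‖T w‖ := fun w =>
      (E w).opNorm_le_bound (norm_nonneg _) fun v => by
        rw [hE]; exact norm_inner_le_norm _ _
    have hTl : ∀ w, ‖w‖ ≤ K * ‖T w‖ := fun w =>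
      (hKE w).trans (mul_le_mul_of_nonneg_left (hET w) hK.le)
    have hTl' : ∀ w, K⁻¹ * ‖w‖ ≤ ‖T w‖ := fun w => by
      rw [inv_mul_le_iff₀ hK]; exact hTl w
    have hSl' : ∀ v, K⁻¹ * ‖v‖ ≤ ‖S v‖ := fun v => by
      rw [inv_mul_le_iff₀ hK]
      obtain ⟨w, hw⟩ := E.surjective (InnerProductSpace.toDual ℝ _ v)
      have hTw : T w = v := by
        refine ext_inner_right ℝ fun z => ?_
        rw [← hE, hw, InnerProductSpace.toDual_apply_apply]
      have h1 : ‖v‖ * ‖v‖ ≤ K * ‖S v‖ * ‖v‖ := by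
        have h2 := hTS w v
        rw [hTw] at h2
        rw [← real_inner_self_eq_norm_mul_norm, h2]
        refine (real_inner_le_norm _ _).trans ?_
        have := hTl w
        rw [hTw] at this
        nlinarith [norm_nonneg (S v)]
      by_cases h0 : ‖v‖ = 0
      · rw [h0]; positivity
      · exact le_of_mul_le_mul_right h1 (lt_of_le_of_ne (norm_nonneg _) (Ne.symm h0))
    have hf1 := LiftAux.fiber_bound B hB T hT K⁻¹ (by positivity) hTl'
    have hf2 := LiftAux.fiber_bound (fun p => (B p).adjoint) hBa S hS K⁻¹ (by positivity) hSl'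
    refine ⟨K⁻¹ / 2, max C (K⁻¹ / 2), by positivity, le_max_right _ _, ?_⟩
    filter_upwards [hC, hBb, hf1, hf2] with p h1 h2 h3 h4
    refine ⟨fun u v => (h1 u v).trans ?_, fun u => ?_, fun v hv => ?_⟩
    · gcongr
      exact le_max_left _ _
    · simp only [← h2]
      rw [LiftAux.iSup_inner]
      exact h3 u
    · refine ⟨(B p).adjoint v, ?_⟩
      rw [← h2, ← ContinuousLinearMap.adjoint_inner_right, inner_self_ne_zero]
      intro h0
      have := h4 v
      rw [h0, norm_zero] at this
      have hv' : 0 < ‖v‖ := norm_pos_iff.2 hv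
      have : 0 < K⁻¹ / 2 * ‖v‖ := by positivity
      linarith
  · rintro ⟨c, Cb, hc, -, h⟩
    have hTl : ∀ w, ‖w‖ ≤ c⁻¹ * ‖T w‖ := by
      intro w
      refine Lp.norm_le_mul_norm_of_ae_le_mul ?_
      filter_upwards [hT w, hBb, h] with p h1 h2 h3
      have h4 := h3.2.1 (w p)
      simp only [← h2] at h4
      rw [LiftAux.iSup_inner] at h4
      rw [h1, le_inv_mul_iff₀ hc]
      exact h4
    have hSi : ∀ v, S v = 0 → v = 0 := by
      intro v hv
      rw [Lp.eq_zero_iff_ae_eq_zero]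
      have hv' := (Lp.eq_zero_iff_ae_eq_zero (f := S v)).1 hv
      filter_upwards [hv', hS v, hBb, h] with p h1 h2 h3 h4
      by_contra hne
      obtain ⟨u, hu⟩ := h4.2.2 (v p) hne
      apply hu
      rw [← h3, ← ContinuousLinearMap.adjoint_inner_right, ← h2, h1]
      simp
    have hadj : T.adjoint = S := by
      symm
      rw [ContinuousLinearMap.eq_adjoint_iff]
      intro x y
      rw [real_inner_comm, ← hTS, real_inner_comm]
    have hanti : AntilipschitzWith (Real.toNNReal c⁻¹) T :=
      ContinuousLinearMap.antilipschitz_of_bound T (by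
        intro x
        rw [Real.coe_toNNReal _ (by positivity)]
        exact hTl x)
    have hcl : IsClosed (T.range : Set (Lp V 2 μ)) := by
      have := hanti.isClosed_range T.uniformContinuous
      exact this
    have hrange : T.range = ⊤ := by
      rw [← hcl.submodule_topologicalClosure_eq, Submodule.topologicalClosure_eq_top_iff,
        ContinuousLinearMap.orthogonal_range, hadj]
      exact (LinearMap.ker_eq_bot').2 hSi
    have hker : T.ker = ⊥ := LinearMap.ker_eq_bot.2 hanti.injective
    let E0 : Lp U 2 μ ≃L[ℝ] Lp V 2 μ := ContinuousLinearEquiv.ofBijective T hker hrange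
    let D : Lp V 2 μ ≃L[ℝ] (Lp V 2 μ →L[ℝ] ℝ) :=
      (InnerProductSpace.toDual ℝ (Lp V 2 μ)).toContinuousLinearEquiv
    exact ⟨E0.trans D, fun w v => rfl⟩
end
end
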